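/- Let $X \in \mathbb{R}^d$, $E = r(X)$ a measurable routing, $Y$ a target, $W_0 \in \mathbb{R}^{d\times d}$ fixed, and $N \sim \mathcal{N}(0, \sigma^2 I_d)$ independent of $(X,E,Y)$. Define $Z_{\mathrm{MoE}} = W_0 X + g_{\phi_E}(X)$ (expert-specific adapters $g_{\phi_e}$) and $Z_{\mathrm{LiME}} = W_0 X + (g_{\phi}(X) \odot p_E)$ (shared adapter $g_\phi$ modulated elementwise by vectors $p_e \in \mathbb{R}^d$). Assume $\|g_{\phi_E}(X) - g_{\phi}(X) \odot p_E\|_2 \leq \bar{\varepsilon}$ almost surely. Let $U^{(\sigma)}_{\mathrm{MoE}} = Z_{\mathrm{MoE}} + N$ and $U^{(\sigma)}_{\mathrm{LiME}} = Z_{\mathrm{LiME}} + N$. Then for any measurable bounded loss $\ell: \mathcal{Y} \times \mathcal{A} \to [0, L_{\max}]$, the optimal risks satisfy $|\mathcal{R}^*(U^{(\sigma)}_{\mathrm{MoE}}) - \mathcal{R}^*(U^{(\sigma)}_{\mathrm{LiME}})| \leq L_{\max} \bar{\varepsilon} / (2\sigma)$. -/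

import Mathlib

open MeasureTheory ProbabilityTheory Real Matrix

/-- The multivariate Gaussian measure `N(μ, σ² I_d)` on `ℝ^d`, realized as the product of
independent one-dimensional Gaussians `N(μ i, σ²)`. -/
noncomputable def gaussianPi {d : ℕ} (μ : Fin d → ℝ) (σ : ℝ) : Measure (Fin d → ℝ) :=
  Measure.pi fun i => gaussianReal (μ i) ⟨σ ^ 2, sq_nonneg σ⟩

/-- The product over coordinates of the one-dimensional densities of `N(a i, σ²)` with respect to
`N(0, σ²)`. -/
noncomputable def gaussianShiftDensity {d : ℕ} (a : Fin d → ℝ) (σ : ℝ) (x : Fin d → ℝ) : ℝ :=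
  ∏ i, exp ((a i * x i - a i ^ 2 / 2) / σ ^ 2)

theorem gaussianReal_eq_withDensity_zero (m : ℝ) {v : NNReal} (hv : v ≠ 0) :
    gaussianReal m v = (gaussianReal 0 v).withDensity
      fun x => ENNReal.ofReal (exp ((m * x - m ^ 2 / 2) / v)) := by
  have hv' : (v : ℝ) ≠ 0 := by exact_mod_cast hv
  rw [gaussianReal_of_var_ne_zero _ hv, gaussianReal_of_var_ne_zero _ hv,
    ← withDensity_mul _ (measurable_gaussianPDF _ _) (by fun_prop)]
  congr 1
  ext x
  rw [Pi.mul_apply, gaussianPDF, gaussianPDF,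
    ← ENNReal.ofReal_mul (gaussianPDFReal_nonneg _ _ _), gaussianPDFReal, gaussianPDFReal,
    mul_assoc, mul_assoc, ← exp_add]
  congr 3
  field_simp
  ring

theorem pi_withDensity_eq {ι : Type*} [Fintype ι] {α : ι → Type*} [∀ i, MeasurableSpace (α i)]
    (ν : ∀ i, Measure (α i)) [∀ i, IsProbabilityMeasure (ν i)] (ρ : ∀ i, α i → ENNReal)
    (hρ : ∀ i, Measurable (ρ i)) [∀ i, SigmaFinite ((ν i).withDensity (ρ i))] :
    Measure.pi (fun i => (ν i).withDensity (ρ i)) =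
      (Measure.pi ν).withDensity fun x => ∏ i, ρ i (x i) := by
  refine Measure.pi_eq fun s hs => ?_
  have hm : ∀ i, Measurable ((s i).indicator (ρ i)) := fun i => (hρ i).indicator (hs i)
  have hind := iIndepFun_pi (μ := ν) fun i => (hm i).aemeasurable
  have hprod := lintegral_prod_eq_prod_lintegral_of_indepFun Finset.univ _ hind
    fun i => (hm i).comp (measurable_pi_apply i)
  rw [withDensity_apply _ (MeasurableSet.univ_pi hs),
    ← lintegral_indicator (MeasurableSet.univ_pi hs)]
  calc _ = ∫⁻ x, ∏ i, (s i).indicator (ρ i) (x i) ∂Measure.pi ν := by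
        refine lintegral_congr fun x => ?_
        by_cases hx : x ∈ Set.univ.pi s
        · rw [Set.indicator_of_mem hx]
          exact Finset.prod_congr rfl fun i _ =>
            (Set.indicator_of_mem (hx i (Set.mem_univ i)) _).symm
        · rw [Set.indicator_of_notMem hx]
          simp only [Set.mem_pi, Set.mem_univ, true_imp_iff, not_forall] at hx
          obtain ⟨i, hi⟩ := hx
          exact (Finset.prod_eq_zero (Finset.mem_univ i) (Set.indicator_of_notMem hi _)).symm
    _ = ∏ i, ∫⁻ x, (s i).indicator (ρ i) (x i) ∂Measure.pi ν := hprod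
    _ = _ := by
        refine Finset.prod_congr rfl fun i _ => ?_
        rw [withDensity_apply _ (hs i), ← lintegral_indicator (hs i)]
        exact (measurePreserving_eval ν i).lintegral_comp (hm i)

section Gaussian

variable {d : ℕ} {σ : ℝ}

theorem gaussianPi_eq_pi (a : Fin d → ℝ) (σ : ℝ) :
    gaussianPi a σ =
      Measure.pi fun i => gaussianReal (a i) (NNReal.mk (σ ^ 2) (sq_nonneg σ)) :=
  rfl

instance isProbabilityMeasure_gaussianPi (a : Fin d → ℝ) (σ : ℝ) :
    IsProbabilityMeasure (gaussianPi a σ) := by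
  rw [gaussianPi_eq_pi]; infer_instance

theorem gaussianPi_eq_map_add (a : Fin d → ℝ) (σ : ℝ) :
    gaussianPi a σ = (gaussianPi 0 σ).map (fun x => a + x) := by
  rw [gaussianPi_eq_pi, gaussianPi_eq_pi]
  have h : ∀ i, gaussianReal (a i) (NNReal.mk (σ ^ 2) (sq_nonneg σ)) =
      (gaussianReal ((0 : Fin d → ℝ) i) (NNReal.mk (σ ^ 2) (sq_nonneg σ))).map (a i + ·) := fun i => by
    rw [gaussianReal_map_const_add, Pi.zero_apply, zero_add]
  have : ∀ i, IsProbabilityMeasure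
      ((gaussianReal ((0 : Fin d → ℝ) i) (NNReal.mk (σ ^ 2) (sq_nonneg σ))).map (a i + ·)) := fun i => by
    rw [← h]; infer_instance
  simp_rw [h]
  rw [← Measure.pi_map_pi fun i => by fun_prop]
  rfl

theorem gaussianPi_eq_withDensity (a : Fin d → ℝ) (hσ : 0 < σ) :
    gaussianPi a σ = (gaussianPi 0 σ).withDensity
      fun x => ENNReal.ofReal (gaussianShiftDensity a σ x) := by
  have hv : ((NNReal.mk (σ ^ 2) (sq_nonneg σ)) : NNReal) ≠ 0 := by
    intro h
    exact (pow_pos hσ 2).ne' (congrArg NNReal.toReal h)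
  rw [gaussianPi_eq_pi, gaussianPi_eq_pi]
  have : ∀ i, IsProbabilityMeasure ((gaussianReal 0 (NNReal.mk (σ ^ 2) (sq_nonneg σ))).withDensity
      fun x => ENNReal.ofReal (exp ((a i * x - a i ^ 2 / 2) / σ ^ 2))) := fun i => by
    have := gaussianReal_eq_withDensity_zero (a i) hv
    rw [NNReal.coe_mk] at this
    rw [← this]; infer_instance
  have h := pi_withDensity_eq (fun _ : Fin d => gaussianReal 0 (NNReal.mk (σ ^ 2) (sq_nonneg σ)))
    (fun i x => ENNReal.ofReal (exp ((a i * x - a i ^ 2 / 2) / σ ^ 2))) (fun i => by fun_prop)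
  simp_rw [gaussianReal_eq_withDensity_zero (a _) hv]
  refine h.trans ?_
  simp only [gaussianShiftDensity, Pi.zero_apply]
  congr 1
  ext x
  exact (ENNReal.ofReal_prod_of_nonneg fun i _ => (exp_pos _).le).symm

theorem gaussianShiftDensity_nonneg (a x : Fin d → ℝ) : 0 ≤ gaussianShiftDensity a σ x :=
  Finset.prod_nonneg fun _ _ => (exp_pos _).le

@[fun_prop]
theorem measurable_gaussianShiftDensity (a : Fin d → ℝ) :
    Measurable (gaussianShiftDensity a σ) := by
  unfold gaussianShiftDensity; fun_prop

theorem integrable_gaussianShiftDensity_pow (a : Fin d → ℝ) (k : ℕ) :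
    Integrable (fun x => gaussianShiftDensity a σ x ^ k) (gaussianPi 0 σ) := by
  simp_rw [gaussianShiftDensity, ← Finset.prod_pow, gaussianPi_eq_pi]
  refine Integrable.fintype_prod
    (f := fun i x => exp ((a i * x - a i ^ 2 / 2) / σ ^ 2) ^ k) fun i => ?_
  have := (integrable_exp_mul_gaussianReal (μ := 0) (v := (NNReal.mk (σ ^ 2) (sq_nonneg σ)))
    (k * a i / σ ^ 2)).mul_const (exp (-(k * (a i ^ 2 / 2) / σ ^ 2)))
  refine this.congr (.of_forall fun x => ?_)
  simp only [← exp_add, ← exp_nat_mul]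
  congr 1
  ring

theorem integral_gaussianShiftDensity_pow (a : Fin d → ℝ) (hσ : 0 < σ) (k : ℕ) :
    ∫ x, gaussianShiftDensity a σ x ^ k ∂gaussianPi 0 σ =
      exp ((k ^ 2 - k) / 2 * (∑ i, a i ^ 2) / σ ^ 2) := by
  simp_rw [gaussianShiftDensity, ← Finset.prod_pow, gaussianPi_eq_pi]
  rw [integral_fintype_prod_eq_prod
    (f := fun i x => exp ((a i * x - a i ^ 2 / 2) / σ ^ 2) ^ k),
    Finset.mul_sum, Finset.sum_div, exp_sum]
  refine Finset.prod_congr rfl fun i _ => ?_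
  have h := congrFun (mgf_id_gaussianReal (μ := 0) (v := (NNReal.mk (σ ^ 2) (sq_nonneg σ))))
    (k * a i / σ ^ 2)
  simp only [mgf, id, NNReal.coe_mk] at h
  calc _ = ∫ x, exp (k * a i / σ ^ 2 * x) * exp (-(k * (a i ^ 2 / 2) / σ ^ 2))
        ∂gaussianReal 0 (NNReal.mk (σ ^ 2) (sq_nonneg σ)) := by
        refine integral_congr_ae (.of_forall fun x => ?_)
        simp only [← exp_add, ← exp_nat_mul]
        congr 1
        ring
    _ = _ := by
        rw [integral_mul_const, h, ← exp_add]
        congr 1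
        field_simp
        ring

theorem integral_gaussianShiftDensity_sub_one_sq (a : Fin d → ℝ) (hσ : 0 < σ) :
    ∫ x, (gaussianShiftDensity a σ x - 1) ^ 2 ∂gaussianPi 0 σ =
      exp ((∑ i, a i ^ 2) / σ ^ 2) - 1 := by
  have h1 := integral_gaussianShiftDensity_pow a hσ 1
  have h2 := integral_gaussianShiftDensity_pow a hσ 2
  have i1 := integrable_gaussianShiftDensity_pow (σ := σ) a 1
  have i2 := integrable_gaussianShiftDensity_pow (σ := σ) a 2
  simp only [pow_one] at h1 i1
  have : ∀ x, (gaussianShiftDensity a σ x - 1) ^ 2 =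
      gaussianShiftDensity a σ x ^ 2 - 2 * gaussianShiftDensity a σ x + 1 := fun x => by ring
  simp_rw [this]
  have i3 : Integrable (fun x => gaussianShiftDensity a σ x ^ 2 - 2 * gaussianShiftDensity a σ x)
      (gaussianPi 0 σ) := i2.sub (i1.const_mul 2)
  rw [integral_add i3 (integrable_const _), integral_sub i2 (i1.const_mul 2), integral_const_mul, h1, h2]
  norm_num
  ring

theorem integral_abs_gaussianShiftDensity_sub_one_le (a : Fin d → ℝ) (hσ : 0 < σ) {s : ℝ}
    (hs : 0 < s) (has : ∑ i, a i ^ 2 ≤ (s * σ) ^ 2) :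
    ∫ x, |gaussianShiftDensity a σ x - 1| ∂gaussianPi 0 σ ≤ s * ((exp (s ^ 2) + 1) / 2) := by
  have i1 : Integrable (fun x => gaussianShiftDensity a σ x - 1) (gaussianPi 0 σ) := by
    have := integrable_gaussianShiftDensity_pow (σ := σ) a 1
    simp only [pow_one] at this
    exact this.sub (integrable_const 1)
  have i2 : Integrable (fun x => (gaussianShiftDensity a σ x - 1) ^ 2) (gaussianPi 0 σ) := by
    refine (((integrable_gaussianShiftDensity_pow (σ := σ) a 2).sub
      (i1.const_mul 2)).sub (integrable_const 1)).congr (.of_forall fun x => ?_)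
    simp only [Pi.sub_apply]
    ring
  calc _ ≤ ∫ x, ((gaussianShiftDensity a σ x - 1) ^ 2 / s + s) / 2 ∂gaussianPi 0 σ := by
        refine integral_mono i1.abs (((i2.div_const s).add (integrable_const s)).div_const 2)
          fun x => ?_
        have h : 0 ≤ (|gaussianShiftDensity a σ x - 1| - s) ^ 2 / s := by positivity
        rw [sub_sq, sq_abs] at h
        have e : ((gaussianShiftDensity a σ x - 1) ^ 2 -
            2 * |gaussianShiftDensity a σ x - 1| * s + s ^ 2) / s =
            (gaussianShiftDensity a σ x - 1) ^ 2 / s + s -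
              2 * |gaussianShiftDensity a σ x - 1| := by
          field_simp
          ring
        rw [e] at h
        simp only
        linarith
    _ = ((exp ((∑ i, a i ^ 2) / σ ^ 2) - 1) / s + s) / 2 := by
        rw [integral_div, integral_add (i2.div_const s) (integrable_const s), integral_div,
          integral_gaussianShiftDensity_sub_one_sq a hσ]
        simp
    _ ≤ ((exp (s ^ 2) - 1) / s + s) / 2 := by
        gcongr
        rw [div_le_iff₀ (by positivity)]
        linarith [mul_pow s σ 2]
    _ ≤ _ := by
        have h : exp (s ^ 2) - 1 ≤ s ^ 2 * exp (s ^ 2) := by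
          have h1 := add_one_le_exp (-s ^ 2)
          have h2 : exp (-s ^ 2) * exp (s ^ 2) = 1 := by rw [← exp_add]; simp
          nlinarith [exp_pos (s ^ 2)]
        have h' : (exp (s ^ 2) - 1) / s ≤ s * exp (s ^ 2) := by
          rw [div_le_iff₀ hs]; linarith
        linarith

variable {f : (Fin d → ℝ) → ℝ} {L : ℝ}

theorem abs_integral_shift_sub_integral_le_of_small (hσ : 0 < σ) (hf : Measurable f)
    (h0 : ∀ x, 0 ≤ f x) (h1 : ∀ x, f x ≤ L) (a : Fin d → ℝ) {s : ℝ} (hs : 0 < s)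
    (has : ∑ i, a i ^ 2 ≤ (s * σ) ^ 2) :
    |∫ x, f (a + x) ∂gaussianPi 0 σ - ∫ x, f x ∂gaussianPi 0 σ| ≤
      L / 2 * (s * ((exp (s ^ 2) + 1) / 2)) := by
  have i1 : Integrable (gaussianShiftDensity a σ) (gaussianPi 0 σ) := by
    simpa using integrable_gaussianShiftDensity_pow (σ := σ) a 1
  have e1 : ∫ x, gaussianShiftDensity a σ x ∂gaussianPi 0 σ = 1 := by
    simpa using integral_gaussianShiftDensity_pow a hσ 1
  have hL : 0 ≤ L := (h0 0).trans (h1 0)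
  have hb : ∀ x, ‖f x‖ ≤ L := fun x => by rw [norm_of_nonneg (h0 x)]; exact h1 x
  have i2 : Integrable f (gaussianPi 0 σ) := .of_bound hf.aestronglyMeasurable L (.of_forall hb)
  have i3 : Integrable (fun x => gaussianShiftDensity a σ x * f x) (gaussianPi 0 σ) :=
    i1.mul_bdd hf.aestronglyMeasurable (.of_forall hb)
  have i5 : Integrable (fun x => gaussianShiftDensity a σ x - 1) (gaussianPi 0 σ) :=
    i1.sub (integrable_const 1)
  have e2 : ∫ x, f (a + x) ∂gaussianPi 0 σ =
      ∫ x, gaussianShiftDensity a σ x * f x ∂gaussianPi 0 σ := by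
    rw [← integral_map (φ := fun x => a + x) (by fun_prop) hf.aestronglyMeasurable,
      ← gaussianPi_eq_map_add, gaussianPi_eq_withDensity a hσ,
      integral_withDensity_eq_integral_toReal_smul (by fun_prop) (by simp)]
    simp [ENNReal.toReal_ofReal (gaussianShiftDensity_nonneg _ _)]
  have e3 : ∫ x, f (a + x) ∂gaussianPi 0 σ - ∫ x, f x ∂gaussianPi 0 σ =
      ∫ x, (gaussianShiftDensity a σ x - 1) * (f x - L / 2) ∂gaussianPi 0 σ := by
    have : ∀ x, (gaussianShiftDensity a σ x - 1) * (f x - L / 2) =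
        gaussianShiftDensity a σ x * f x - f x - (gaussianShiftDensity a σ x - 1) * (L / 2) :=
      fun x => by ring
    have i4 : Integrable (fun x => gaussianShiftDensity a σ x * f x - f x) (gaussianPi 0 σ) :=
      i3.sub i2
    simp_rw [this]
    rw [integral_sub i4 (i5.mul_const _),
      integral_sub i3 i2, integral_mul_const, integral_sub i1 (integrable_const 1), e1, e2]
    simp
  rw [e3, ← norm_eq_abs]
  calc _ ≤ ∫ x, |gaussianShiftDensity a σ x - 1| * (L / 2) ∂gaussianPi 0 σ := by
        refine norm_integral_le_of_norm_le (i5.abs.mul_const _) (.of_forall fun x => ?_)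
        rw [norm_mul, norm_eq_abs, norm_eq_abs]
        gcongr
        rw [abs_le]
        constructor <;> linarith [h0 x, h1 x]
    _ ≤ _ := by
        rw [integral_mul_const, mul_comm]
        gcongr
        exact integral_abs_gaussianShiftDensity_sub_one_le a hσ hs has

theorem abs_integral_shift_sub_integral_le (hσ : 0 < σ) (hf : Measurable f)
    (h0 : ∀ x, 0 ≤ f x) (h1 : ∀ x, f x ≤ L) (a : Fin d → ℝ) {c : ℝ} (hc : 0 < c)
    (hac : ∑ i, a i ^ 2 ≤ (c * σ) ^ 2) :
    |∫ x, f (a + x) ∂gaussianPi 0 σ - ∫ x, f x ∂gaussianPi 0 σ| ≤ L / 2 * c := by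
  have hn : ∀ n : ℕ, |∫ x, f (a + x) ∂gaussianPi 0 σ - ∫ x, f x ∂gaussianPi 0 σ| ≤
      L / 2 * (c * ((exp ((c / (n + 1 : ℕ)) ^ 2) + 1) / 2)) := by
    intro n
    set m := n + 1
    have hm : (0 : ℝ) < m := by positivity
    set F : ℕ → ℝ := fun k => ∫ x, f (((k : ℝ) / m) • a + x) ∂gaussianPi 0 σ
    have hstep : ∀ k < m, dist (F k) (F (k + 1)) ≤
        L / 2 * (c / m * ((exp ((c / m) ^ 2) + 1) / 2)) := by
      intro k _
      have := abs_integral_shift_sub_integral_le_of_small hσ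
        (f := fun x => f (((k : ℝ) / m) • a + x)) (by fun_prop) (fun x => h0 _) (fun x => h1 _)
        ((1 / m : ℝ) • a) (s := c / m) (by positivity) (by
          simp only [Pi.smul_apply, smul_eq_mul, mul_pow, ← Finset.mul_sum]
          rw [mul_pow] at hac
          calc _ ≤ (1 / (m : ℝ)) ^ 2 * (c ^ 2 * σ ^ 2) := by gcongr
            _ = _ := by ring)
      rw [dist_comm, dist_eq]
      convert this using 5
      push_cast
      rw [← add_assoc, ← add_smul]
      ring_nf
    have h := dist_le_range_sum_of_dist_le (f := F) m (fun {k} hk => hstep k hk)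
    rw [Finset.sum_const, Finset.card_range, nsmul_eq_mul, dist_comm, dist_eq] at h
    simp only [F, div_self hm.ne', one_smul, Nat.cast_zero, zero_div, zero_smul, zero_add] at h
    refine h.trans (le_of_eq ?_)
    field_simp
  have hlim : Filter.Tendsto
      (fun n : ℕ => L / 2 * (c * ((exp ((c / (n + 1 : ℕ)) ^ 2) + 1) / 2))) Filter.atTop
      (nhds (L / 2 * (c * ((exp (0 ^ 2) + 1) / 2)))) := by
    have h := (tendsto_const_div_atTop_nhds_zero_nat c).comp (Filter.tendsto_add_atTop_nat 1)
    exact (((((continuous_exp.tendsto _).comp (h.pow 2)).add_const 1).div_const 2).const_mul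
      c).const_mul (L / 2)
  have := ge_of_tendsto' hlim hn
  norm_num at this
  exact this

end Gaussian

theorem abs_ciInf_sub_ciInf_le {ι : Sort*} [Nonempty ι] {u v : ι → ℝ} {B : ℝ}
    (hu : BddBelow (Set.range u)) (hv : BddBelow (Set.range v)) (h : ∀ i, |u i - v i| ≤ B) :
    |(⨅ i, u i) - ⨅ i, v i| ≤ B := by
  rw [abs_sub_le_iff]
  constructor
  · rw [sub_le_comm]
    exact le_ciInf fun i => by linarith [ciInf_le hu i, (abs_le.1 (h i)).2]
  · rw [sub_le_comm]
    exact le_ciInf fun i => by linarith [ciInf_le hv i, (abs_le.1 (h i)).1]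

/-- LiME approximates expert-specific PEFT, smoothed version.
The noise `N ~ N(0, σ² I_d)` independent of `(X, E, Y)` is realized by working on the
product space `Ω × ℝ^d` with the product measure `μ ⊗ N(0, σ² I_d)`; the noise is the
second coordinate. `𝓡*(U) = inf_δ E[ℓ(Y, δ(U))]` over measurable decision rules `δ`. -/
theorem lime_approximates_moe {Ω 𝒴 𝒜 : Type*}
    [MeasurableSpace Ω] [MeasurableSpace 𝒴] [MeasurableSpace 𝒜] [Nonempty 𝒜]
    (μ : Measure Ω) [IsProbabilityMeasure μ] {d n : ℕ}
    (X : Ω → (Fin d → ℝ)) (hX : Measurable X)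
    (r : (Fin d → ℝ) → Fin n) (hr : Measurable r)
    (Y : Ω → 𝒴) (hY : Measurable Y)
    (W₀ : Matrix (Fin d) (Fin d) ℝ)
    (gE : Fin n → (Fin d → ℝ) → (Fin d → ℝ)) (hgE : ∀ e, Measurable (gE e))
    (g : (Fin d → ℝ) → (Fin d → ℝ)) (hg : Measurable g)
    (p : Fin n → (Fin d → ℝ))
    (σ : ℝ) (hσ : 0 < σ) (εbar Lmax : ℝ)
    -- `‖g_{φ_E}(X) - g_φ(X) ⊙ p_E‖₂ ≤ ε̄` almost surely
    (happrox : ∀ᵐ ω ∂μ,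
      Real.sqrt (∑ i, (gE (r (X ω)) (X ω) i - g (X ω) i * p (r (X ω)) i) ^ 2) ≤ εbar)
    (ℓ : 𝒴 × 𝒜 → ℝ) (hℓ : Measurable ℓ) (h0 : ∀ q, 0 ≤ ℓ q) (h1 : ∀ q, ℓ q ≤ Lmax) :
    |(⨅ δ : {f : (Fin d → ℝ) → 𝒜 // Measurable f},
        ∫ ωx : Ω × (Fin d → ℝ),
          ℓ (Y ωx.1, δ.1 (fun i =>
            W₀.mulVec (X ωx.1) i + gE (r (X ωx.1)) (X ωx.1) i + ωx.2 i))
          ∂(μ.prod (gaussianPi 0 σ)))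
      - (⨅ δ : {f : (Fin d → ℝ) → 𝒜 // Measurable f},
        ∫ ωx : Ω × (Fin d → ℝ),
          ℓ (Y ωx.1, δ.1 (fun i =>
            W₀.mulVec (X ωx.1) i + g (X ωx.1) i * p (r (X ωx.1)) i + ωx.2 i))
          ∂(μ.prod (gaussianPi 0 σ)))|
      ≤ Lmax * εbar / (2 * σ) := by
  have hεbar : 0 ≤ εbar := by
    obtain ⟨ω, hω⟩ := happrox.exists
    exact (Real.sqrt_nonneg _).trans hω
  have : Nonempty {f : (Fin d → ℝ) → 𝒜 // Measurable f} :=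
    ⟨⟨fun _ => Classical.arbitrary 𝒜, measurable_const⟩⟩
  have hmE : Measurable fun ω => gE (r (X ω)) (X ω) :=
    (measurable_from_prod_countable_right (f := fun q : Fin n × (Fin d → ℝ) => gE q.1 q.2)
      hgE).comp ((hr.comp hX).prodMk hX)
  have hmp : Measurable fun ω => p (r (X ω)) := (measurable_of_finite p).comp (hr.comp hX)
  have hmW : Measurable fun ω => W₀.mulVec (X ω) := by
    refine measurable_pi_lambda _ fun i => ?_
    simp only [Matrix.mulVec, dotProduct]
    fun_prop
  have hmMoE : Measurable fun q : Ω × (Fin d → ℝ) => fun i =>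
      W₀.mulVec (X q.1) i + gE (r (X q.1)) (X q.1) i + q.2 i :=
    ((hmW.add hmE).comp measurable_fst).add measurable_snd
  have hmLiME : Measurable fun q : Ω × (Fin d → ℝ) => fun i =>
      W₀.mulVec (X q.1) i + g (X q.1) i * p (r (X q.1)) i + q.2 i := by
    fun_prop
  have hint : ∀ (U : Ω × (Fin d → ℝ) → Fin d → ℝ), Measurable U →
      ∀ δ : {f : (Fin d → ℝ) → 𝒜 // Measurable f},
        Integrable (fun q => ℓ (Y q.1, δ.1 (U q))) (μ.prod (gaussianPi 0 σ)) := fun U hU δ =>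
    .of_bound (hℓ.comp ((hY.comp measurable_fst).prodMk
      (δ.2.comp hU))).aestronglyMeasurable Lmax
      (.of_forall fun q => by rw [norm_of_nonneg (h0 _)]; exact h1 _)
  refine abs_ciInf_sub_ciInf_le ⟨0, ?_⟩ ⟨0, ?_⟩ fun δ => ?_
  · rintro _ ⟨δ, rfl⟩
    exact integral_nonneg fun _ => h0 _
  · rintro _ ⟨δ, rfl⟩
    exact integral_nonneg fun _ => h0 _
  have i1 := hint _ hmMoE δ
  have i2 := hint _ hmLiME δ
  rw [integral_prod _ i1, integral_prod _ i2, ← integral_sub i1.integral_prod_left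
    i2.integral_prod_left, ← norm_eq_abs]
  refine (norm_integral_le_of_norm_le_const (C := Lmax * εbar / (2 * σ)) ?_).trans
    (by simp)
  filter_upwards [happrox] with ω hω
  have hsq := (Real.sqrt_le_left hεbar).1 hω
  rw [norm_eq_abs]
  rcases hεbar.eq_or_lt with rfl | hpos
  · have hz : ∀ i, gE (r (X ω)) (X ω) i = g (X ω) i * p (r (X ω)) i := fun i => by
      have := (Finset.sum_eq_zero_iff_of_nonneg fun i _ => sq_nonneg _).1
        (le_antisymm (by simpa using hsq) (Finset.sum_nonneg fun i _ => sq_nonneg _)) i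
        (Finset.mem_univ i)
      exact sub_eq_zero.1 (pow_eq_zero_iff two_ne_zero |>.1 this)
    simp [hz]
  have hδ := δ.2
  have key := abs_integral_shift_sub_integral_le hσ
    (f := fun x => ℓ (Y ω, δ.1 (fun i =>
      W₀.mulVec (X ω) i + g (X ω) i * p (r (X ω)) i + x i)))
    (by fun_prop) (fun _ => h0 _) (fun _ => h1 _)
    (fun i => gE (r (X ω)) (X ω) i - g (X ω) i * p (r (X ω)) i) (c := εbar / σ)
    (by positivity) (by rwa [div_mul_cancel₀ _ hσ.ne'])
  convert! key using 1
  · congr! 8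
    simp only [Pi.add_apply]
    ring
  · field_simp
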